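/- Let K ∈ ℝ and N ∈ (0,∞), and let (P_t) be a tracially symmetric quantum Markov semigroup on M_n(ℂ) with Lindblad form satisfying the gradient estimate GE(K,N) for the logarithmic mean. For an invertible density matrix ρ, set φ(t) := −Ent(P_tρ) = −τ((P_tρ)·log(P_tρ)). Then φ is twice differentiable on [0,∞), φ'(t) = τ((L P_tρ)·log(P_tρ)) ≥ 0, and φ''(t) ≤ −2K·φ'(t) − (2/N)·φ'(t)² for all t ≥ 0. -/

import Mathlib

open Matrix Filter
open scoped ComplexOrder ENNReal Kronecker

namespace CD

abbrev Mat (ι : Type*) := Matrix ι ι ℂ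

variable {ι : Type*}

noncomputable def trn [Fintype ι] (x : Mat ι) : ℂ :=
  (Fintype.card ι : ℂ)⁻¹ * x.trace

noncomputable def inn [Fintype ι] (x y : Mat ι) : ℂ := trn (xᴴ * y)

def matLE [Fintype ι] (A B : Mat ι) : Prop := (B - A).PosSemidef

def blockify [Fintype ι] {m : ℕ} (B : Fin m → Fin m → Mat ι) :
    Matrix (Fin m × ι) (Fin m × ι) ℂ :=
  Matrix.of fun p q => B p.1 q.1 p.2 q.2

def IsCP [Fintype ι] (Φ : Mat ι →ₗ[ℂ] Mat ι) : Prop :=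
  ∀ (m : ℕ) (B : Fin m → Fin m → Mat ι),
    (blockify B).PosSemidef → (blockify fun j k => Φ (B j k)).PosSemidef

structure QMS (ι : Type*) [Fintype ι] [DecidableEq ι] where
  P : ℝ → Mat ι →ₗ[ℂ] Mat ι
  gen : Mat ι →ₗ[ℂ] Mat ι
  P_zero : P 0 = LinearMap.id
  P_add : ∀ s t : ℝ, P (s + t) = (P s) ∘ₗ (P t)
  P_cp : ∀ t : ℝ, 0 ≤ t → IsCP (P t)
  P_unital : ∀ t : ℝ, 0 ≤ t → P t 1 = 1
  P_cont : ∀ (x : Mat ι) (i j : ι), Continuous fun t : ℝ => P t x i j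
  P_deriv : ∀ (x : Mat ι) (i j : ι),
    HasDerivAt (fun t : ℝ => P t x i j) (-(gen x i j)) 0

variable [Fintype ι] [DecidableEq ι]

def TraciallySymm (Q : QMS ι) : Prop :=
  ∀ t : ℝ, 0 ≤ t → ∀ x y : Mat ι, trn (Q.P t x * y) = trn (x * Q.P t y)

noncomputable def Gamma (L : Mat ι →ₗ[ℂ] Mat ι) (a b : Mat ι) : Mat ι :=
  (2:ℂ)⁻¹ • (aᴴ * L b + (L a)ᴴ * b - L (aᴴ * b))

noncomputable def Gamma2 (L : Mat ι →ₗ[ℂ] Mat ι) (a b : Mat ι) : Mat ι :=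
  (2:ℂ)⁻¹ • (Gamma L a (L b) + Gamma L (L a) b - L (Gamma L a b))

noncomputable def BE (L : Mat ι →ₗ[ℂ] Mat ι) (K ν : ℝ) : Prop :=
  ∀ a : Mat ι, matLE (K • Gamma L a a + ν • ((L a)ᴴ * (L a))) (Gamma2 L a a)

noncomputable def cK (K t : ℝ) : ℝ :=
  if K = 0 then 2 * t else (1 - Real.exp (-(2 * K * t))) / K

noncomputable def comm (v x : Mat ι) : Mat ι := v * x - x * v

def LindbladForm (L : Mat ι →ₗ[ℂ] Mat ι) {d : ℕ} (v : Fin d → Mat ι) : Prop :=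
  (∀ j, ∃ k, (v j)ᴴ = v k) ∧ ∀ x, L x = ∑ j, comm ((v j)ᴴ) (comm (v j) x)

def Intertwining (Q : QMS ι) {d : ℕ} (v : Fin d → Mat ι) (K : ℝ) : Prop :=
  ∀ t : ℝ, 0 ≤ t → ∀ (j : Fin d) (x : Mat ι),
    comm (v j) (Q.P t x) = Real.exp (-(K * t)) • Q.P t (comm (v j) x)

def CBE (L : Mat ι →ₗ[ℂ] Mat ι) (K ν : ℝ) : Prop :=
  ∀ (m : ℕ) (x : Fin m → Mat ι),
    (blockify (fun j k => Gamma2 L (x j) (x k)) -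
      (K • blockify (fun j k => Gamma L (x j) (x k)) +
       ν • blockify (fun j k => (L (x j))ᴴ * (L (x k))))).PosSemidef

def IsDensity (ρ : Mat ι) : Prop := ρ.PosSemidef ∧ trn ρ = 1

def IsInvDensity (ρ : Mat ι) : Prop := ρ.PosDef ∧ trn ρ = 1

def sliceL {κ : Type*} (x : Mat (ι × κ)) (a b : κ) : Mat ι :=
  Matrix.of fun i j => x (i, a) (j, b)

def sliceR {κ : Type*} (x : Mat (κ × ι)) (a b : κ) : Mat ι :=
  Matrix.of fun i j => x (a, i) (b, j)

noncomputable def lTensor (Φ : Mat ι →ₗ[ℂ] Mat ι) (κ : Type*) :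
    Mat (ι × κ) →ₗ[ℂ] Mat (ι × κ) where
  toFun x := Matrix.of fun p q => Φ (sliceL x p.2 q.2) p.1 q.1
  map_add' x y := by
    ext p q
    have h : sliceL (x + y) p.2 q.2 = sliceL x p.2 q.2 + sliceL y p.2 q.2 := rfl
    simp only [Matrix.of_apply, h, map_add, Matrix.add_apply]
  map_smul' c x := by
    ext p q
    have h : sliceL (c • x) p.2 q.2 = c • sliceL x p.2 q.2 := rfl
    simp only [Matrix.of_apply, h, _root_.map_smul, Matrix.smul_apply, RingHom.id_apply]

noncomputable def rTensor (Ψ : Mat ι →ₗ[ℂ] Mat ι) (κ : Type*) :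
    Mat (κ × ι) →ₗ[ℂ] Mat (κ × ι) where
  toFun x := Matrix.of fun p q => Ψ (sliceR x p.1 q.1) p.2 q.2
  map_add' x y := by
    ext p q
    have h : sliceR (x + y) p.1 q.1 = sliceR x p.1 q.1 + sliceR y p.1 q.1 := rfl
    simp only [Matrix.of_apply, h, map_add, Matrix.add_apply]
  map_smul' c x := by
    ext p q
    have h : sliceR (c • x) p.1 q.1 = c • sliceR x p.1 q.1 := rfl
    simp only [Matrix.of_apply, h, _root_.map_smul, Matrix.smul_apply, RingHom.id_apply]

end CD

namespace CD

variable {ι : Type*} [Fintype ι] [DecidableEq ι]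

/-- Real power `ρ^s` of a (positive) matrix via continuous functional calculus. -/
noncomputable def mpow (ρ : Mat ι) (s : ℝ) : Mat ι := cfc (fun x : ℝ => x ^ s) ρ

/-- Matrix logarithm via continuous functional calculus. -/
noncomputable def mlog (ρ : Mat ι) : Mat ι := cfc Real.log ρ

/-- The logarithmic mean `ρ̂(x) = ∫₀¹ ρ^s x ρ^{1−s} ds` (entrywise integral). -/
noncomputable def logMean (ρ x : Mat ι) : Mat ι :=
  Matrix.of fun i j => ∫ s in (0:ℝ)..1, (mpow ρ s * x * mpow ρ (1 - s)) i j

/-- `‖∂a‖²_ρ = ∑ⱼ ⟨ρ̂(∂ⱼa), ∂ⱼa⟩` for the logarithmic mean. -/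
noncomputable def dNormSqLog {J : Type*} [Fintype J] (v : J → Mat ι)
    (ρ a : Mat ι) : ℝ :=
  ∑ j, (inn (logMean ρ (comm (v j) a)) (comm (v j) a)).re

/-- The gradient estimate `GE(K,N)` for the logarithmic mean (`ν = 1/N`). -/
noncomputable def GElog {J : Type*} [Fintype J] (P : ℝ → Mat ι →ₗ[ℂ] Mat ι)
    (L : Mat ι →ₗ[ℂ] Mat ι) (v : J → Mat ι) (K ν : ℝ) : Prop :=
  ∀ t : ℝ, 0 ≤ t → ∀ a ρ : Mat ι, ρ.PosDef → trn ρ = 1 →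
    dNormSqLog v ρ (P t a) ≤
      Real.exp (-(2 * K * t)) * dNormSqLog v (P t ρ) a -
        ν * cK K t * Complex.normSq (inn a (L (P t ρ)))

/-- The (relative) entropy `Ent(ρ) = τ(ρ log ρ)`. -/
noncomputable def Ent (ρ : Mat ι) : ℝ := (trn (ρ * mlog ρ)).re

end CD

namespace CD

variable {ι : Type*} [Fintype ι]

lemma trn_zero : trn (0 : Mat ι) = 0 := by simp [trn]

lemma trn_add (x y : Mat ι) : trn (x + y) = trn x + trn y := by
  simp [trn, Matrix.trace_add, mul_add]

lemma trn_sub (x y : Mat ι) : trn (x - y) = trn x - trn y := by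
  simp [trn, Matrix.trace_sub, mul_sub]

lemma trn_mul_comm (x y : Mat ι) : trn (x * y) = trn (y * x) := by
  simp [trn, Matrix.trace_mul_comm x y]

lemma trn_conjTranspose (x : Mat ι) : trn xᴴ = star (trn x) := by
  simp [trn, Matrix.trace_conjTranspose]

lemma inn_comm_comm (v x y : Mat ι) : inn (comm v x) (comm v y) = inn (comm vᴴ (comm v x)) y := by
  simp only [inn, comm, conjTranspose_sub, conjTranspose_mul, conjTranspose_conjTranspose,
    sub_mul, mul_sub, trn_sub, Matrix.mul_assoc]
  have h (a b c d : Mat ι) : trn (a * (b * (c * d))) = trn (d * (a * (b * c))) := by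
    rw [trn_mul_comm d]
    simp only [Matrix.mul_assoc]
  rw [h xᴴ vᴴ y v, h vᴴ xᴴ y v]

lemma re_inn_isHermitian (x : Mat ι) {a : Mat ι} (ha : a.IsHermitian) :
    (inn x a).re = (trn (x * a)).re := by
  have h : inn x a = star (trn (x * a)) := by
    rw [← trn_conjTranspose, conjTranspose_mul, ha.eq, inn, trn_mul_comm]
  rw [h, Complex.star_def, Complex.conj_re]

lemma sum_inn_comm_comm {L : Mat ι →ₗ[ℂ] Mat ι} {d : ℕ} {v : Fin d → Mat ι}
    (hL : LindbladForm L v) (x y : Mat ι) :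
    ∑ j, inn (comm (v j) x) (comm (v j) y) = inn (L x) y := by
  rw [hL.2]
  simp only [inn_comm_comm]
  simp only [inn, trn, conjTranspose_sum, Finset.sum_mul, Matrix.trace_sum, Finset.mul_sum]

variable [DecidableEq ι]

/-- A Hermitian matrix is unitarily diagonalizable, it is positive definite iff its eigenvalues are
positive, and the functional calculus acts on the eigenvalues. -/
lemma exists_unitary_diagonal_of_isHermitian {ρ : Mat ι} (hρ : ρ.IsHermitian) :
    ∃ (U : Mat ι) (l : ι → ℝ), Uᴴ * U = 1 ∧ U * Uᴴ = 1 ∧ (ρ.PosDef ↔ ∀ i, 0 < l i) ∧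
      ρ = U * diagonal (fun i => (l i : ℂ)) * Uᴴ ∧
      ∀ f : ℝ → ℝ, cfc f ρ = U * diagonal (fun i => (f (l i) : ℂ)) * Uᴴ := by
  have key : ∀ f : ℝ → ℝ, cfc f ρ = (hρ.eigenvectorUnitary : Mat ι) *
      diagonal (fun i => (f (hρ.eigenvalues i) : ℂ)) * (hρ.eigenvectorUnitary : Mat ι)ᴴ := by
    intro f
    rw [hρ.cfc_eq, Matrix.IsHermitian.cfc, Unitary.conjStarAlgAut_apply]
    rfl
  refine ⟨hρ.eigenvectorUnitary, hρ.eigenvalues, ?_, ?_, hρ.posDef_iff_eigenvalues_pos, ?_, key⟩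
  · exact Unitary.coe_star_mul_self hρ.eigenvectorUnitary
  · exact Unitary.coe_mul_star_self hρ.eigenvectorUnitary
  · have h := key id
    rwa [cfc_id ℝ ρ hρ.isSelfAdjoint] at h

lemma exists_unitary_diagonal {ρ : Mat ι} (hρ : ρ.PosDef) :
    ∃ (U : Mat ι) (l : ι → ℝ), Uᴴ * U = 1 ∧ U * Uᴴ = 1 ∧ (∀ i, 0 < l i) ∧
      ρ = U * diagonal (fun i => (l i : ℂ)) * Uᴴ ∧
      ∀ f : ℝ → ℝ, cfc f ρ = U * diagonal (fun i => (f (l i) : ℂ)) * Uᴴ := by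
  obtain ⟨U, l, hU, hU', hl, hρ', hf⟩ := exists_unitary_diagonal_of_isHermitian hρ.1
  exact ⟨U, l, hU, hU', hl.1 hρ, hρ', hf⟩

lemma isHermitian_mlog (ρ : Mat ι) : (mlog ρ).IsHermitian :=
  (cfc_predicate Real.log ρ : IsSelfAdjoint (mlog ρ)).isHermitian

lemma trace_diagonal_mul_diagonal (f g : ι → ℝ) (U V : Mat ι) :
    ((U * diagonal (fun i => (f i : ℂ)) * Uᴴ) * (V * diagonal (fun i => (g i : ℂ)) * Vᴴ)).trace =
      ((∑ i, ∑ j, f i * g j * Complex.normSq ((Uᴴ * V) i j) : ℝ) : ℂ) := by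
  have h : ((U * diagonal (fun i => (f i : ℂ)) * Uᴴ) *
      (V * diagonal (fun i => (g i : ℂ)) * Vᴴ)).trace =
      (diagonal (fun i => (f i : ℂ)) * ((Uᴴ * V) * (diagonal (fun i => (g i : ℂ)) *
        (Uᴴ * V)ᴴ))).trace := by
    rw [Matrix.conjTranspose_mul, conjTranspose_conjTranspose]
    simp only [Matrix.mul_assoc]
    rw [Matrix.trace_mul_comm]
    simp only [Matrix.mul_assoc]
  rw [h, Matrix.trace]
  push_cast
  refine Finset.sum_congr rfl fun i _ => ?_
  rw [Matrix.diag_apply, Matrix.diagonal_mul, Matrix.mul_apply, Finset.mul_sum]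
  refine Finset.sum_congr rfl fun j _ => ?_
  rw [Matrix.diagonal_mul, Matrix.conjTranspose_apply, ← Complex.mul_conj]
  simp only [Complex.star_def]
  ring

/-- **Klein's inequality** for the relative entropy. -/
lemma trn_sub_le_trn_mul_mlog_sub {σ ρ : Mat ι} (hσ : σ.PosDef) (hρ : ρ.PosDef) :
    (trn σ - trn ρ).re ≤ (trn (σ * (mlog σ - mlog ρ))).re := by
  obtain ⟨U, l, hU, hU', hl, hσ', hf⟩ := exists_unitary_diagonal hσ
  obtain ⟨V, m, hV, hV', hm, hρ', hg⟩ := exists_unitary_diagonal hρ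
  have one_U : (1 : Mat ι) = U * diagonal (fun i => (((fun _ => 1 : ι → ℝ) i : ℝ) : ℂ)) * Uᴴ := by
    simp [hU']
  have one_V : (1 : Mat ι) = V * diagonal (fun i => (((fun _ => 1 : ι → ℝ) i : ℝ) : ℂ)) * Vᴴ := by
    simp [hV']
  have h1 : (σ * mlog σ).trace =
      ((∑ i, ∑ j, (l i * Real.log (l i)) * 1 * Complex.normSq ((Uᴴ * V) i j) : ℝ) : ℂ) := by
    rw [← trace_diagonal_mul_diagonal (fun i => l i * Real.log (l i)) (fun _ => 1), ← one_V,
      mul_one, mlog, hf]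
    nth_rw 1 [hσ']
    congr 1
    calc _ = U * (diagonal (fun i => (l i : ℂ)) * (Uᴴ * U) *
          diagonal (fun i => (Real.log (l i) : ℂ))) * Uᴴ := by simp only [Matrix.mul_assoc]
      _ = _ := by
        rw [hU, mul_one, diagonal_mul_diagonal]
        simp only [Complex.ofReal_mul]
  have h2 : (σ * mlog ρ).trace =
      ((∑ i, ∑ j, l i * Real.log (m j) * Complex.normSq ((Uᴴ * V) i j) : ℝ) : ℂ) := by
    rw [← trace_diagonal_mul_diagonal l (fun j => Real.log (m j)), mlog, hg, ← hσ']
  have h3 : σ.trace =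
      ((∑ i, ∑ j, l i * 1 * Complex.normSq ((Uᴴ * V) i j) : ℝ) : ℂ) := by
    rw [← trace_diagonal_mul_diagonal l (fun _ => 1), ← one_V, mul_one, ← hσ']
  have h4 : ρ.trace =
      ((∑ i, ∑ j, 1 * m j * Complex.normSq ((Uᴴ * V) i j) : ℝ) : ℂ) := by
    rw [← trace_diagonal_mul_diagonal (fun _ => 1) m, ← one_U, one_mul, ← hρ']
  rw [mul_sub, trn_sub]
  simp only [trn]
  rw [h1, h2, h3, h4]
  have hcard : ((Fintype.card ι : ℂ)⁻¹) = (((Fintype.card ι : ℝ)⁻¹ : ℝ) : ℂ) := by push_cast; rfl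
  rw [hcard]
  simp only [← Complex.ofReal_mul, ← Complex.ofReal_sub, Complex.ofReal_re, ← mul_sub]
  refine mul_le_mul_of_nonneg_left ?_ (by positivity)
  simp only [← Finset.sum_sub_distrib]
  refine Finset.sum_le_sum fun i _ => Finset.sum_le_sum fun j _ => ?_
  have hlog : Real.log (m j / l i) ≤ m j / l i - 1 :=
    Real.log_le_sub_one_of_pos (div_pos (hm j) (hl i))
  rw [Real.log_div (hm j).ne' (hl i).ne'] at hlog
  have h5 : l i * (Real.log (m j) - Real.log (l i)) ≤ m j - l i := by
    calc _ ≤ l i * (m j / l i - 1) := mul_le_mul_of_nonneg_left hlog (hl i).le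
      _ = m j - l i := by field_simp [(hl i).ne']
  have h6 := mul_le_mul_of_nonneg_right h5 (Complex.normSq_nonneg ((Uᴴ * V) i j))
  linarith

/-- The logarithmic mean of two positive numbers. -/
noncomputable def scalarLogMean (a b : ℝ) : ℝ := ∫ s in (0:ℝ)..1, a ^ s * b ^ (1 - s)

lemma continuous_rpow_mul_rpow {a b : ℝ} (ha : 0 < a) (hb : 0 < b) :
    Continuous fun s : ℝ => a ^ s * b ^ (1 - s) :=
  (Real.continuous_const_rpow ha.ne').mul
    ((Real.continuous_const_rpow hb.ne').comp (continuous_const.sub continuous_id))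

lemma scalarLogMean_nonneg {a b : ℝ} (ha : 0 < a) (hb : 0 < b) : 0 ≤ scalarLogMean a b :=
  intervalIntegral.integral_nonneg zero_le_one fun _ _ =>
    mul_nonneg (Real.rpow_nonneg ha.le _) (Real.rpow_nonneg hb.le _)

lemma scalarLogMean_mul_log_sub {a b : ℝ} (ha : 0 < a) (hb : 0 < b) :
    scalarLogMean a b * (Real.log b - Real.log a) = b - a := by
  have hd : ∀ s ∈ Set.uIcc (0:ℝ) 1, HasDerivAt (fun s : ℝ => a ^ s * b ^ (1 - s))
      (a ^ s * b ^ (1 - s) * (Real.log a - Real.log b)) s := by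
    intro s _
    have h1 := (hasDerivAt_id s).const_rpow ha
    have h2 := ((hasDerivAt_id s).const_sub 1).const_rpow hb
    convert! h1.mul h2 using 1
    simp only [id]
    ring
  have h := intervalIntegral.integral_eq_sub_of_hasDerivAt hd
    (((continuous_rpow_mul_rpow ha hb).mul continuous_const).intervalIntegrable 0 1)
  rw [intervalIntegral.integral_mul_const] at h
  simp only [sub_self, sub_zero, Real.rpow_one, Real.rpow_zero, one_mul, mul_one] at h
  rw [scalarLogMean]
  linarith

lemma logMean_eq {ρ U : Mat ι} {l : ι → ℝ} (hl : ∀ i, 0 < l i)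
    (hf : ∀ f : ℝ → ℝ, cfc f ρ = U * diagonal (fun i => (f (l i) : ℂ)) * Uᴴ) (x : Mat ι) :
    logMean ρ x =
      U * Matrix.of (fun i j => (scalarLogMean (l i) (l j) : ℂ) * (Uᴴ * x * U) i j) * Uᴴ := by
  ext i j
  have hentry : ∀ s : ℝ, (mpow ρ s * x * mpow ρ (1 - s)) i j =
      ∑ b, ∑ a, ((l a ^ s * l b ^ (1 - s) : ℝ) : ℂ) *
        (U i a * (Uᴴ * x * U) a b * Uᴴ b j) := by
    intro s
    have h : mpow ρ s * x * mpow ρ (1 - s) =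
        U * (diagonal (fun i => ((l i ^ s : ℝ) : ℂ)) * (Uᴴ * x * U) *
          diagonal (fun i => ((l i ^ (1 - s) : ℝ) : ℂ))) * Uᴴ := by
      rw [mpow, mpow, hf, hf]
      simp only [Matrix.mul_assoc]
    rw [h, Matrix.mul_apply]
    refine Finset.sum_congr rfl fun b _ => ?_
    rw [Matrix.mul_apply, Finset.sum_mul]
    refine Finset.sum_congr rfl fun a _ => ?_
    rw [Matrix.mul_diagonal, Matrix.diagonal_mul]
    push_cast
    ring
  have hcont : ∀ a b, Continuous fun s : ℝ => ((l a ^ s * l b ^ (1 - s) : ℝ) : ℂ) *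
        (U i a * (Uᴴ * x * U) a b * Uᴴ b j) := fun a b =>
    (Complex.continuous_ofReal.comp (continuous_rpow_mul_rpow (hl a) (hl b))).mul
      continuous_const
  rw [logMean, Matrix.of_apply]
  simp only [hentry]
  rw [intervalIntegral.integral_finsetSum
    fun b _ => (continuous_finsetSum _ fun a _ => hcont a b).intervalIntegrable _ _,
    Matrix.mul_apply]
  refine Finset.sum_congr rfl fun b _ => ?_
  rw [intervalIntegral.integral_finsetSum fun a _ => (hcont a b).intervalIntegrable _ _,
    Matrix.mul_apply, Finset.sum_mul]
  refine Finset.sum_congr rfl fun a _ => ?_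
  rw [intervalIntegral.integral_mul_const, intervalIntegral.integral_ofReal, Matrix.of_apply,
    ← scalarLogMean]
  ring

lemma logMean_comm_mlog {ρ : Mat ι} (hρ : ρ.PosDef) (v : Mat ι) :
    logMean ρ (comm v (mlog ρ)) = comm v ρ := by
  obtain ⟨U, l, hU, hU', hl, hρ', hf⟩ := exists_unitary_diagonal hρ
  have hc : ∀ (g : ι → ℝ) (i j : ι),
      (Uᴴ * comm v (U * diagonal (fun i => (g i : ℂ)) * Uᴴ) * U) i j =
        ((g j - g i : ℝ) : ℂ) * (Uᴴ * v * U) i j := by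
    intro g i j
    have h : Uᴴ * comm v (U * diagonal (fun i => (g i : ℂ)) * Uᴴ) * U =
        (Uᴴ * v * U) * diagonal (fun i => (g i : ℂ)) * (Uᴴ * U) -
          (Uᴴ * U) * diagonal (fun i => (g i : ℂ)) * (Uᴴ * v * U) := by
      simp only [comm, mul_sub, sub_mul, Matrix.mul_assoc]
    rw [h, hU, mul_one, one_mul, Matrix.sub_apply, Matrix.mul_diagonal, Matrix.diagonal_mul]
    push_cast
    ring
  have hback : comm v ρ = U * (Uᴴ * comm v ρ * U) * Uᴴ := by
    calc comm v ρ = (U * Uᴴ) * comm v ρ * (U * Uᴴ) := by rw [hU', one_mul, mul_one]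
      _ = _ := by simp only [Matrix.mul_assoc]
  rw [hback, logMean_eq hl hf]
  congr 2
  ext i j
  rw [Matrix.of_apply, mlog, hf, hc (fun i => Real.log (l i)), hρ', hc l,
    ← scalarLogMean_mul_log_sub (hl i) (hl j)]
  push_cast
  ring

lemma exists_inn_logMean {ρ : Mat ι} (hρ : ρ.PosDef) :
    ∃ (M : ι → ι → ℝ) (U : Mat ι), (∀ i j, 0 ≤ M i j) ∧ ∀ x y : Mat ι,
      inn (logMean ρ x) y = (Fintype.card ι : ℂ)⁻¹ *
        ∑ j, ∑ i, (M i j : ℂ) * (star ((Uᴴ * x * U) i j) * (Uᴴ * y * U) i j) := by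
  obtain ⟨U, l, hU, hU', hl, hρ', hf⟩ := exists_unitary_diagonal hρ
  refine ⟨fun i j => scalarLogMean (l i) (l j), U,
    fun i j => scalarLogMean_nonneg (hl i) (hl j), fun x y => ?_⟩
  rw [inn, trn, logMean_eq hl hf]
  congr 1
  rw [conjTranspose_mul, conjTranspose_mul, conjTranspose_conjTranspose, Matrix.mul_assoc,
    Matrix.trace_mul_comm]
  simp only [Matrix.mul_assoc]
  rw [Matrix.trace]
  refine Finset.sum_congr rfl fun j _ => ?_
  rw [Matrix.diag_apply, Matrix.mul_apply]
  refine Finset.sum_congr rfl fun i _ => ?_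
  rw [conjTranspose_apply, Matrix.of_apply, star_mul']
  simp only [Complex.star_def, Complex.conj_ofReal]
  ring

/-- Completing the square for the positive form `⟨ρ̂ x, y⟩`. -/
lemma two_mul_inn_logMean_sub_le {ρ : Mat ι} (hρ : ρ.PosDef) (x y : Mat ι) :
    2 * (inn (logMean ρ y) x).re - (inn (logMean ρ y) y).re ≤ (inn (logMean ρ x) x).re := by
  obtain ⟨M, U, hM, hB⟩ := exists_inn_logMean hρ
  rw [hB, hB, hB]
  have hcard : ((Fintype.card ι : ℂ)⁻¹) = (((Fintype.card ι : ℝ)⁻¹ : ℝ) : ℂ) := by push_cast; rfl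
  rw [hcard]
  simp only [Complex.re_ofReal_mul, Complex.re_sum]
  rw [mul_left_comm, ← mul_sub]
  refine mul_le_mul_of_nonneg_left ?_ (by positivity)
  simp only [Finset.mul_sum, ← Finset.sum_sub_distrib]
  refine Finset.sum_le_sum fun j _ => Finset.sum_le_sum fun i _ => ?_
  rw [mul_left_comm, ← mul_sub]
  refine mul_le_mul_of_nonneg_left ?_ (hM i j)
  simp only [Complex.mul_re, Complex.star_def, Complex.conj_re, Complex.conj_im]
  nlinarith [sq_nonneg (((Uᴴ * x * U) i j).re - ((Uᴴ * y * U) i j).re),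
    sq_nonneg (((Uᴴ * x * U) i j).im - ((Uᴴ * y * U) i j).im)]

lemma inn_logMean_self_nonneg {ρ : Mat ι} (hρ : ρ.PosDef) (x : Mat ι) :
    0 ≤ (inn (logMean ρ x) x).re := by
  obtain ⟨M, U, hM, hB⟩ := exists_inn_logMean hρ
  have hcard : ((Fintype.card ι : ℂ)⁻¹) = (((Fintype.card ι : ℝ)⁻¹ : ℝ) : ℂ) := by push_cast; rfl
  rw [hB, hcard]
  simp only [Complex.re_ofReal_mul, Complex.re_sum]
  refine mul_nonneg (by positivity)
    (Finset.sum_nonneg fun j _ => Finset.sum_nonneg fun i _ => mul_nonneg (hM i j) ?_)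
  simp only [Complex.mul_re, Complex.star_def, Complex.conj_re, Complex.conj_im]
  nlinarith [mul_self_nonneg ((Uᴴ * x * U) i j).re, mul_self_nonneg ((Uᴴ * x * U) i j).im]

lemma dNormSqLog_mlog {L : Mat ι →ₗ[ℂ] Mat ι} {d : ℕ} {v : Fin d → Mat ι}
    (hL : LindbladForm L v) {ρ : Mat ι} (hρ : ρ.PosDef) :
    dNormSqLog v ρ (mlog ρ) = (inn (L ρ) (mlog ρ)).re := by
  rw [dNormSqLog, ← sum_inn_comm_comm hL, Complex.re_sum]
  simp only [logMean_comm_mlog hρ]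

lemma two_mul_inn_gen_sub_le {L : Mat ι →ₗ[ℂ] Mat ι} {d : ℕ} {v : Fin d → Mat ι}
    (hL : LindbladForm L v) {ρ : Mat ι} (hρ : ρ.PosDef) (a : Mat ι) :
    2 * (inn (L ρ) a).re - (inn (L ρ) (mlog ρ)).re ≤ dNormSqLog v ρ a := by
  rw [dNormSqLog, ← sum_inn_comm_comm hL, ← sum_inn_comm_comm hL, Complex.re_sum, Complex.re_sum,
    Finset.mul_sum, ← Finset.sum_sub_distrib]
  refine Finset.sum_le_sum fun j _ => ?_
  have h := two_mul_inn_logMean_sub_le hρ (comm (v j) a) (comm (v j) (mlog ρ))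
  rwa [logMean_comm_mlog hρ] at h

end CD

namespace CD

section Norm

open scoped Matrix.Norms.L2Operator

variable {ι : Type*} [Fintype ι] [DecidableEq ι]

/-- Coefficients of the power series of `x ↦ log (1 - x)`. -/
noncomputable def logCoeff (n : ℕ) : ℂ := -(n : ℂ)⁻¹

lemma hasSum_logCoeff {x : ℝ} (hx : |x| < 1) :
    HasSum (fun n : ℕ => logCoeff n * (x : ℂ) ^ n) (Real.log (1 - x) : ℂ) := by
  have h := (Real.hasSum_pow_div_log_of_abs_lt_one hx).neg
  rw [neg_neg] at h
  have h2 : HasSum (fun n : ℕ => -((n : ℝ))⁻¹ * x ^ n) (Real.log (1 - x)) := by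
    rw [← hasSum_nat_add_iff' 1]
    simp only [Finset.range_one, Finset.sum_singleton, Nat.cast_zero, _root_.inv_zero, neg_zero,
      zero_mul, sub_zero]
    refine h.congr_fun fun n => ?_
    push_cast
    ring
  have h3 := (Complex.hasSum_ofReal (f := fun n : ℕ => -((n : ℝ))⁻¹ * x ^ n)).2 h2
  convert! h3 using 2 with n
  simp [logCoeff]

lemma differentiableAt_ofScalarsSum_logCoeff {x : Mat ι} (hx : ‖x‖ < 1) :
    DifferentiableAt ℂ (FormalMultilinearSeries.ofScalarsSum (E := Mat ι) logCoeff) x := by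
  set p := FormalMultilinearSeries.ofScalars (Mat ι) logCoeff with hp
  have hr : ((1 : NNReal) : ENNReal) ≤ p.radius := by
    refine p.le_radius_of_bound (max 1 ‖p 0‖) fun n => ?_
    rcases Nat.eq_zero_or_pos n with rfl | hn
    · simp
    · have h1 : ‖p n‖ ≤ ‖logCoeff n‖ := FormalMultilinearSeries.ofScalars_norm_le _ _ n hn
      have h2 : ‖logCoeff n‖ ≤ 1 := by
        simp only [logCoeff, norm_neg, norm_inv, Complex.norm_natCast]
        exact inv_le_one_of_one_le₀ (by exact_mod_cast hn)
      simpa using Or.inl (h1.trans h2)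
  have hpos : 0 < p.radius := lt_of_lt_of_le (by simp) hr
  have hball := p.hasFPowerSeriesOnBall hpos
  refine (hball.analyticAt_of_mem ?_).differentiableAt
  rw [Metric.mem_eball, edist_zero_right]
  refine lt_of_lt_of_le ?_ hr
  rw [← ofReal_norm, ENNReal.coe_one, ENNReal.ofReal_lt_one]
  exact hx

lemma norm_unitary_conj {U : Mat ι} (hU : Uᴴ * U = 1) (hU' : U * Uᴴ = 1) (A : Mat ι) :
    ‖U * A * Uᴴ‖ = ‖A‖ := by
  have hu : U ∈ unitary (Mat ι) := Unitary.mem_iff.2 ⟨hU, hU'⟩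
  have hu' : Uᴴ ∈ unitary (Mat ι) := Unitary.star_mem hu
  rw [CStarRing.norm_mul_mem_unitary _ hu', CStarRing.norm_mem_unitary_mul _ hu]

lemma one_sub_smul_eq {σ U : Mat ι} {l : ι → ℝ} (hU' : U * Uᴴ = 1)
    (hσ : σ = U * diagonal (fun i => (l i : ℂ)) * Uᴴ) (c : ℝ) :
    1 - (c : ℂ) • σ = U * diagonal (fun i => ((1 - c * l i : ℝ) : ℂ)) * Uᴴ := by
  have h : diagonal (fun i => ((1 - c * l i : ℝ) : ℂ)) =
      1 - (c : ℂ) • diagonal (fun i => (l i : ℂ)) := by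
    rw [← diagonal_one, ← diagonal_smul]
    ext i j
    rcases eq_or_ne i j with rfl | hij
    · simp
    · simp [hij]
  rw [h, mul_sub, sub_mul, mul_one, hU', Matrix.mul_smul, Matrix.smul_mul, ← hσ]

lemma norm_one_sub_smul_lt_one_iff {σ U : Mat ι} {l : ι → ℝ} (hU : Uᴴ * U = 1) (hU' : U * Uᴴ = 1)
    (hσ : σ = U * diagonal (fun i => (l i : ℂ)) * Uᴴ) (c : ℝ) :
    ‖1 - (c : ℂ) • σ‖ < 1 ↔ ∀ i, |1 - c * l i| < 1 := by
  rw [one_sub_smul_eq hU' hσ, norm_unitary_conj hU hU', l2_opNorm_diagonal,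
    pi_norm_lt_iff one_pos]
  simp only [Complex.norm_real, Real.norm_eq_abs]

/-- Near the identity, up to scaling, the matrix logarithm is given by its power series. -/
lemma mlog_eq_ofScalarsSum {σ : Mat ι} (hσ : σ.PosDef) {c : ℝ} (hc : 0 < c)
    (hn : ‖1 - (c : ℂ) • σ‖ < 1) :
    mlog σ = -(Real.log c : ℂ) • 1 +
      FormalMultilinearSeries.ofScalarsSum logCoeff (1 - (c : ℂ) • σ) := by
  obtain ⟨U, l, hU, hU', hl, hσ', hf⟩ := exists_unitary_diagonal hσ
  have h1 := one_sub_smul_eq hU' hσ' c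
  have habs := (norm_one_sub_smul_lt_one_iff hU hU' hσ' c).1 hn
  have hpow : ∀ n : ℕ, (U * diagonal (fun i => ((1 - c * l i : ℝ) : ℂ)) * Uᴴ) ^ n =
      U * diagonal (fun i => ((1 - c * l i : ℝ) : ℂ) ^ n) * Uᴴ := by
    intro n
    induction n with
    | zero => simp [hU']
    | succ n ih =>
      rw [pow_succ, ih]
      calc _ = U * (diagonal (fun i => ((1 - c * l i : ℝ) : ℂ) ^ n) * (Uᴴ * U) *
            diagonal (fun i => ((1 - c * l i : ℝ) : ℂ))) * Uᴴ := by simp only [Matrix.mul_assoc]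
        _ = _ := by
          rw [hU, mul_one, diagonal_mul_diagonal]
          simp only [pow_succ]
  have hsum : HasSum (fun n : ℕ => logCoeff n • (1 - (c : ℂ) • σ) ^ n)
      (U * diagonal (fun i => (Real.log (1 - (1 - c * l i)) : ℂ)) * Uᴴ) := by
    have hpi : HasSum (fun (n : ℕ) (i : ι) => logCoeff n * ((1 - c * l i : ℝ) : ℂ) ^ n)
        (fun i => (Real.log (1 - (1 - c * l i)) : ℂ)) :=
      Pi.hasSum.2 fun i => hasSum_logCoeff (habs i)
    have h := (hpi.matrix_diagonal.mul_left U).mul_right Uᴴ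
    convert! h using 2 with n
    rw [h1, hpow, ← Matrix.smul_mul, ← Matrix.mul_smul, ← diagonal_smul]
    rfl
  rw [FormalMultilinearSeries.ofScalars_sum_eq, hsum.tsum_eq, mlog, hf]
  have hlog : (fun i => (Real.log (1 - (1 - c * l i)) : ℂ)) =
      fun i => (Real.log c : ℂ) + (Real.log (l i) : ℂ) := by
    ext i
    rw [sub_sub_cancel, Real.log_mul hc.ne' (hl i).ne', Complex.ofReal_add]
  rw [hlog, ← diagonal_add, mul_add, add_mul]
  have hone : U * diagonal (fun _ => (Real.log c : ℂ)) * Uᴴ = (Real.log c : ℂ) • 1 := by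
    rw [← smul_one_eq_diagonal, Matrix.mul_smul, Matrix.smul_mul, mul_one, hU']
  rw [hone, neg_smul, neg_add_cancel_left]

lemma exists_norm_one_sub_smul_lt {ρ : Mat ι} (hρ : ρ.PosDef) :
    ∃ c : ℝ, 0 < c ∧ ‖1 - (c : ℂ) • ρ‖ < 1 := by
  obtain ⟨U, l, hU, hU', hl, hρ', -⟩ := exists_unitary_diagonal hρ
  have hs : 0 ≤ ∑ i, l i := Finset.sum_nonneg fun i _ => (hl i).le
  have hc : 0 < (1 + ∑ i, l i)⁻¹ := by positivity
  refine ⟨(1 + ∑ i, l i)⁻¹, hc, ?_⟩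
  set c := (1 + ∑ i, l i)⁻¹ with hc'
  rw [norm_one_sub_smul_lt_one_iff hU hU' hρ']
  intro i
  rw [abs_lt]
  have h2 : l i ≤ ∑ i, l i := Finset.single_le_sum (fun i _ => (hl i).le) (Finset.mem_univ i)
  have h3 : c * l i < 1 := by
    rw [hc', inv_mul_lt_iff₀ (by positivity)]
    linarith
  have h4 : 0 < c * l i := mul_pos hc (hl i)
  constructor <;> linarith

/-- The matrix logarithm is differentiable along differentiable paths of positive matrices. -/
lemma differentiableAt_mlog_comp {R : ℝ → Mat ι} {t : ℝ} (hR : DifferentiableAt ℝ R t)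
    (hpos : ∀ᶠ s in nhds t, (R s).PosDef) :
    DifferentiableAt ℝ (fun s => mlog (R s)) t := by
  obtain ⟨c, hc, hn⟩ := exists_norm_one_sub_smul_lt hpos.self_of_nhds
  have hinner : DifferentiableAt ℝ (fun s => 1 - (c : ℂ) • R s) t :=
    (hR.const_smul (c : ℂ)).const_sub 1
  have hev : ∀ᶠ s in nhds t, ‖1 - (c : ℂ) • R s‖ < 1 :=
    hinner.continuousAt.norm.eventually_lt_const hn
  have hlog : (fun s => mlog (R s)) =ᶠ[nhds t] fun s => -(Real.log c : ℂ) • (1 : Mat ι) +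
      FormalMultilinearSeries.ofScalarsSum logCoeff (1 - (c : ℂ) • R s) := by
    filter_upwards [hpos, hev] with s h1 h2
    exact mlog_eq_ofScalarsSum h1 hc h2
  refine DifferentiableAt.congr_of_eventuallyEq ?_ hlog
  refine DifferentiableAt.const_add _ ?_
  exact DifferentiableAt.comp t
    ((differentiableAt_ofScalarsSum_logCoeff hn).restrictScalars ℝ) hinner

/-- Entrywise differentiability implies differentiability for the operator norm. -/
lemma hasDerivAt_matrix {R : ℝ → Mat ι} {R' : Mat ι} {t : ℝ}
    (h : ∀ i j, HasDerivAt (fun s => R s i j) (R' i j) t) : HasDerivAt R R' t := by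
  have hs : ∀ A : Mat ι, A = ∑ i, ∑ j, A i j • Matrix.single i j (1 : ℂ) := by
    intro A
    conv_lhs => rw [Matrix.matrix_eq_sum_single A]
    simp
  rw [hs R', show R = fun s => ∑ i, ∑ j, R s i j • Matrix.single i j (1 : ℂ) from
    funext fun s => hs (R s)]
  exact HasDerivAt.fun_sum fun i _ => HasDerivAt.fun_sum fun j _ => (h i j).smul_const _

/-- Positive definiteness is an open condition among Hermitian matrices. -/
lemma eventually_posDef {R : ℝ → Mat ι} {t : ℝ} (hR : ContinuousAt R t)
    (hherm : ∀ s, (R s).IsHermitian) (hpos : (R t).PosDef) :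
    ∀ᶠ s in nhds t, (R s).PosDef := by
  obtain ⟨c, hc, hn⟩ := exists_norm_one_sub_smul_lt hpos
  have hev : ∀ᶠ s in nhds t, ‖1 - (c : ℂ) • R s‖ < 1 :=
    ((hR.const_smul (c : ℂ)).const_sub 1 |>.norm).eventually_lt_const hn
  filter_upwards [hev] with s hs
  obtain ⟨U, l, hU, hU', hl, hσ, -⟩ := exists_unitary_diagonal_of_isHermitian (hherm s)
  rw [norm_one_sub_smul_lt_one_iff hU hU' hσ] at hs
  refine hl.2 fun i => ?_
  have h := (abs_lt.1 (hs i)).2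
  exact pos_of_mul_pos_right (by linarith : 0 < c * l i) hc.le

end Norm

section Semigroup

open scoped Matrix.Norms.L2Operator

variable {ι : Type*} [Fintype ι]

lemma IsCP.map_conjTranspose {Φ : Mat ι →ₗ[ℂ] Mat ι} (hΦ : IsCP Φ)
    (h1 : ∃ e : Mat ι, eᴴ = e ∧ ∀ x, e * x = x) (x : Mat ι) : Φ xᴴ = (Φ x)ᴴ := by
  obtain ⟨e, he, hex⟩ := h1
  let b : Fin 2 → Mat ι := ![e, x]
  let C : Matrix ι (Fin 2 × ι) ℂ := Matrix.of fun i p => b p.1 i p.2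
  have hC : blockify (fun j k => (b j)ᴴ * b k) = Cᴴ * C := by
    ext p q
    simp [blockify, C, Matrix.mul_apply]
  have hpos := hΦ 2 (fun j k => (b j)ᴴ * b k)
    (by rw [hC]; exact posSemidef_conjTranspose_mul_self C)
  have hxe : xᴴ * e = xᴴ := by
    rw [← conjTranspose_inj, conjTranspose_mul, conjTranspose_conjTranspose, he, hex]
  ext i j
  have h := congr_fun (congr_fun hpos.1.eq (1, i)) (0, j)
  simp only [blockify, conjTranspose_apply, Matrix.of_apply, b, Matrix.cons_val_zero,
    Matrix.cons_val_one, he, hex, hxe] at h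
  rw [conjTranspose_apply, h]

lemma IsCP.map_posSemidef {Φ : Mat ι →ₗ[ℂ] Mat ι} (hΦ : IsCP Φ) {x : Mat ι}
    (hx : x.PosSemidef) : (Φ x).PosSemidef := by
  have h := hΦ 1 (fun _ _ => x) (hx.submatrix Prod.snd)
  exact h.submatrix fun i => ((0 : Fin 1), i)

variable [DecidableEq ι] (Q : QMS ι)

namespace QMS

lemma P_add_apply (s t : ℝ) (x : Mat ι) : Q.P (s + t) x = Q.P s (Q.P t x) := by
  rw [Q.P_add, LinearMap.comp_apply]

lemma P_neg_apply (t : ℝ) (x : Mat ι) : Q.P (-t) (Q.P t x) = x := by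
  rw [← Q.P_add_apply, neg_add_cancel, Q.P_zero, LinearMap.id_apply]

lemma P_conjTranspose (t : ℝ) (x : Mat ι) : Q.P t xᴴ = (Q.P t x)ᴴ := by
  have hnonneg : ∀ t : ℝ, 0 ≤ t → ∀ x, Q.P t xᴴ = (Q.P t x)ᴴ := fun t ht =>
    (Q.P_cp t ht).map_conjTranspose ⟨1, conjTranspose_one, one_mul⟩
  rcases le_total 0 t with ht | ht
  · exact hnonneg t ht x
  · have h := hnonneg (-t) (by linarith) (Q.P t x)
    rw [Q.P_neg_apply] at h
    have h2 := Q.P_neg_apply (-t) (Q.P t x)ᴴ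
    rwa [neg_neg, h] at h2

lemma isHermitian_P {x : Mat ι} (hx : x.IsHermitian) (t : ℝ) : (Q.P t x).IsHermitian := by
  rw [Matrix.IsHermitian, ← Q.P_conjTranspose, hx.eq]

lemma posDef_P {x : Mat ι} (hx : x.PosDef) {t : ℝ} (ht : 0 ≤ t) : (Q.P t x).PosDef := by
  obtain ⟨U, l, hU, hU', hl, hx', -⟩ := exists_unitary_diagonal hx
  obtain ⟨ε, hε, hεl⟩ : ∃ ε : ℝ, 0 < ε ∧ ∀ i, ε ≤ l i := by
    rcases isEmpty_or_nonempty ι with h | h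
    · exact ⟨1, one_pos, fun i => h.elim i⟩
    · obtain ⟨i, hi⟩ := Finite.exists_min l
      exact ⟨l i, hl i, hi⟩
  have hsub : (x - (ε : ℂ) • 1).PosSemidef := by
    have h : x - (ε : ℂ) • 1 = U * diagonal (fun i => ((l i - ε : ℝ) : ℂ)) * Uᴴ := by
      have hd : diagonal (fun i => ((l i - ε : ℝ) : ℂ)) =
          diagonal (fun i => (l i : ℂ)) - (ε : ℂ) • 1 := by
        ext i j
        rcases eq_or_ne i j with rfl | hij
        · simp
        · simp [hij]
      rw [hd, mul_sub, sub_mul, ← hx', Matrix.mul_smul, Matrix.smul_mul, mul_one, hU']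
    rw [h]
    refine (PosSemidef.diagonal fun i => ?_).mul_mul_conjTranspose_same U
    simpa using hεl i
  have h := (Q.P_cp t ht).map_posSemidef hsub
  rw [map_sub, _root_.map_smul, Q.P_unital t ht] at h
  have h1 : ((ε : ℂ) • (1 : Mat ι)).PosDef := PosDef.one.smul (by exact_mod_cast hε)
  simpa using h1.add_posSemidef h

lemma trn_P (hsymm : TraciallySymm Q) (t : ℝ) (x : Mat ι) : trn (Q.P t x) = trn x := by
  have hnonneg : ∀ t : ℝ, 0 ≤ t → ∀ x, trn (Q.P t x) = trn x := fun t ht x => by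
    have h := hsymm t ht x 1
    rwa [mul_one, Q.P_unital t ht, mul_one] at h
  rcases le_total 0 t with ht | ht
  · exact hnonneg t ht x
  · have h := hnonneg (-t) (by linarith) (Q.P t x)
    rwa [Q.P_neg_apply, eq_comm] at h

lemma hasDerivAt_P (x : Mat ι) (t : ℝ) :
    HasDerivAt (fun s => Q.P s x) (-Q.gen (Q.P t x)) t := by
  have h0 : HasDerivAt (fun s => Q.P s (Q.P t x)) (-Q.gen (Q.P t x)) (t - t) := by
    rw [sub_self]
    exact hasDerivAt_matrix fun i j => Q.P_deriv (Q.P t x) i j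
  have h := h0.comp_sub_const t t
  simpa only [← Q.P_add_apply, sub_add_cancel] using h

lemma gen_P (t : ℝ) (x : Mat ι) : Q.gen (Q.P t x) = Q.P t (Q.gen x) := by
  have h1 := Q.hasDerivAt_P (Q.P t x) 0
  have h2 := (LinearMap.toContinuousLinearMap
    ((Q.P t).restrictScalars ℝ)).hasFDerivAt.comp_hasDerivAt (0 : ℝ) (Q.hasDerivAt_P x 0)
  have h3 : (fun s => Q.P s (Q.P t x)) =
      (LinearMap.toContinuousLinearMap ((Q.P t).restrictScalars ℝ)) ∘ fun s => Q.P s x := by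
    ext1 s
    simp only [Function.comp_apply, LinearMap.coe_toContinuousLinearMap',
      LinearMap.coe_restrictScalars]
    rw [← Q.P_add_apply, ← Q.P_add_apply, add_comm]
  rw [h3] at h1
  have h4 := h1.unique h2
  simpa [Q.P_zero] using h4

end QMS

/-- The entropy production `τ((L P_t ρ) log (P_t ρ))` at time `t`. -/
noncomputable def entropyProduction (ρ : Mat ι) (t : ℝ) : ℝ :=
  (trn (Q.gen (Q.P t ρ) * mlog (Q.P t ρ))).re

/-- The real part of the normalized trace as a continuous real-linear functional. -/
noncomputable def reTrn (ι : Type*) [Fintype ι] [DecidableEq ι] : Mat ι →L[ℝ] ℝ :=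
  LinearMap.toContinuousLinearMap
    { toFun := fun x => (trn x).re
      map_add' := fun x y => by rw [trn_add, Complex.add_re]
      map_smul' := fun c x => by simp [trn, mul_left_comm] }

lemma reTrn_apply (x : Mat ι) : reTrn ι x = (trn x).re := rfl

variable {Q}

lemma eventually_posDef_P {ρ : Mat ι} (hρ : ρ.PosDef) {t : ℝ} (ht : 0 ≤ t) :
    ∀ᶠ s in nhds t, (Q.P s ρ).PosDef :=
  eventually_posDef (Q.hasDerivAt_P ρ t).continuousAt (Q.isHermitian_P hρ.1) (Q.posDef_P hρ ht)

lemma differentiableAt_mlog_P {ρ : Mat ι} {t : ℝ}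
    (h : ∀ᶠ s in nhds t, (Q.P s ρ).PosDef) :
    DifferentiableAt ℝ (fun s => mlog (Q.P s ρ)) t :=
  differentiableAt_mlog_comp (Q.hasDerivAt_P ρ t).differentiableAt h

lemma differentiableAt_entropyProduction {ρ : Mat ι} {t : ℝ}
    (h : ∀ᶠ s in nhds t, (Q.P s ρ).PosDef) :
    DifferentiableAt ℝ (entropyProduction Q ρ) t := by
  have h1 : DifferentiableAt ℝ (fun s => Q.gen (Q.P s ρ)) t := by
    simp only [Q.gen_P]
    exact (Q.hasDerivAt_P (Q.gen ρ) t).differentiableAt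
  exact (reTrn ι).differentiableAt.comp t (h1.mul (differentiableAt_mlog_P h))

lemma hasDerivAt_neg_Ent_P (hsymm : TraciallySymm Q) {ρ : Mat ι} {t : ℝ}
    (h : ∀ᶠ s in nhds t, (Q.P s ρ).PosDef) :
    HasDerivAt (fun s => -Ent (Q.P s ρ)) (entropyProduction Q ρ t) t := by
  set R : ℝ → Mat ι := fun s => Q.P s ρ with hR
  have hRd : HasDerivAt R (-Q.gen (R t)) t := Q.hasDerivAt_P ρ t
  obtain ⟨M', hM⟩ : ∃ M', HasDerivAt (fun s => mlog (R s)) M' t :=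
    ⟨_, (differentiableAt_mlog_P h).hasDerivAt⟩
  have htr : ∀ s, trn (R s) = trn ρ := fun s => Q.trn_P hsymm s ρ
  have hlin : HasDerivAt (fun s => reTrn ι ((R s - R t) * mlog (R t)))
      (-entropyProduction Q ρ t) t := by
    have h1 := (reTrn ι).hasFDerivAt.comp_hasDerivAt t
      ((hRd.sub_const (R t)).mul_const (mlog (R t)))
    convert! h1 using 1
    rw [neg_mul, map_neg]
    rfl
  have hquad : HasDerivAt (fun s => reTrn ι ((R s - R t) * (mlog (R s) - mlog (R t)))) 0 t := by
    have h1 := (reTrn ι).hasFDerivAt.comp_hasDerivAt t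
      ((hRd.sub_const (R t)).mul (hM.sub_const (mlog (R t))))
    convert! h1 using 1
    simp
  have hrem : HasDerivAt
      (fun s => Ent (R s) - Ent (R t) - reTrn ι ((R s - R t) * mlog (R t))) 0 t := by
    rw [hasDerivAt_iff_isLittleO] at hquad ⊢
    refine Asymptotics.IsBigO.trans_isLittleO (Asymptotics.IsBigO.of_bound 1 ?_) hquad
    filter_upwards [h] with s hs
    have k1 := trn_sub_le_trn_mul_mlog_sub hs h.self_of_nhds
    have k2 := trn_sub_le_trn_mul_mlog_sub h.self_of_nhds hs
    change (trn (R s) - trn (R t)).re ≤ (trn (R s * (mlog (R s) - mlog (R t)))).re at k1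
    change (trn (R t) - trn (R s)).re ≤ (trn (R t * (mlog (R t) - mlog (R s)))).re at k2
    rw [htr, htr, sub_self, Complex.zero_re] at k1 k2
    simp only [Ent, reTrn_apply, sub_self, zero_mul, smul_zero, sub_zero, mul_sub, sub_mul,
      trn_sub, trn_zero, Complex.zero_re, Complex.sub_re, one_mul, Real.norm_eq_abs, map_sub] at k1 k2 ⊢
    rw [abs_of_nonneg (by linarith), abs_of_nonneg (by linarith)]
    linarith
  have hsum := ((hrem.add hlin).add_const (Ent (R t))).neg
  convert! hsum using 1
  · ext s
    simp [hR]
  · ring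

lemma re_inn_gen_P_mlog (ρ : Mat ι) (t : ℝ) :
    (inn (Q.gen (Q.P t ρ)) (mlog (Q.P t ρ))).re = entropyProduction Q ρ t :=
  re_inn_isHermitian _ (isHermitian_mlog _)

lemma entropyProduction_nonneg {d : ℕ} {v : Fin d → Mat ι} (hL : LindbladForm Q.gen v)
    {ρ : Mat ι} {t : ℝ} (h : (Q.P t ρ).PosDef) : 0 ≤ entropyProduction Q ρ t := by
  rw [← re_inn_gen_P_mlog, ← dNormSqLog_mlog hL h]
  exact Finset.sum_nonneg fun j _ => inn_logMean_self_nonneg h _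

lemma hasDerivAt_cK (K : ℝ) : HasDerivAt (cK K) 2 0 := by
  unfold cK
  split_ifs with hK
  · simpa using (hasDerivAt_id (0 : ℝ)).const_mul 2
  · have h : HasDerivAt (fun t : ℝ => -(2 * K * t)) (-(2 * K * 1)) 0 :=
      ((hasDerivAt_id (0 : ℝ)).const_mul (2 * K)).neg
    convert! ((h.exp.const_sub 1).div_const K) using 1
    simp
    field_simp

lemma cK_zero (K : ℝ) : cK K 0 = 0 := by
  simp [cK]

lemma cK_nonneg (K : ℝ) {t : ℝ} (ht : 0 ≤ t) : 0 ≤ cK K t := by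
  unfold cK
  split_ifs with hK
  · positivity
  · rcases lt_or_gt_of_ne hK with h | h
    · refine div_nonneg_of_nonpos ?_ h.le
      have : 1 ≤ Real.exp (-(2 * K * t)) := Real.one_le_exp (by nlinarith)
      linarith
    · refine div_nonneg ?_ h.le
      have : Real.exp (-(2 * K * t)) ≤ 1 := Real.exp_le_one_iff.2 (by nlinarith)
      linarith

/-- The gradient estimate, applied to `a = log (P_{t+s} ρ)`, bounds the entropy production. -/
lemma entropyProduction_le (hsymm : TraciallySymm Q) {d : ℕ} {v : Fin d → Mat ι}
    (hL : LindbladForm Q.gen v) {K ν : ℝ} (hν : 0 ≤ ν) (hGE : GElog Q.P Q.gen v K ν)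
    {ρ : Mat ι} (hρ : ρ.PosDef) (hρ1 : trn ρ = 1) {s t : ℝ} (hs : 0 ≤ s) (ht : 0 ≤ t) :
    2 * entropyProduction Q ρ (t + s) - entropyProduction Q ρ t ≤
      Real.exp (-(2 * K * s)) * entropyProduction Q ρ (t + s) -
        ν * cK K s * entropyProduction Q ρ (t + s) ^ 2 := by
  set a := mlog (Q.P (t + s) ρ) with ha
  have hpos := Q.posDef_P hρ ht
  have hPs : Q.P s (Q.P t ρ) = Q.P (t + s) ρ := by rw [← Q.P_add_apply, add_comm]
  have hge := hGE s hs a (Q.P t ρ) hpos (by rw [Q.trn_P hsymm, hρ1])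
  have hlow := two_mul_inn_gen_sub_le hL hpos (Q.P s a)
  have hcross : inn (Q.gen (Q.P t ρ)) (Q.P s a) = inn (Q.gen (Q.P (t + s) ρ)) a := by
    rw [inn, ← hsymm s hs, Q.P_conjTranspose, ← Q.gen_P, hPs, inn]
  rw [hcross, re_inn_gen_P_mlog, re_inn_gen_P_mlog] at hlow
  rw [hPs, dNormSqLog_mlog hL (Q.posDef_P hρ (add_nonneg ht hs)), re_inn_gen_P_mlog] at hge
  have hE : inn a (Q.gen (Q.P (t + s) ρ)) = trn (Q.gen (Q.P (t + s) ρ) * a) := by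
    rw [inn, (isHermitian_mlog _).eq, trn_mul_comm]
  have hsq : entropyProduction Q ρ (t + s) ^ 2 ≤
      Complex.normSq (inn a (Q.gen (Q.P (t + s) ρ))) := by
    rw [hE, Complex.normSq_apply, entropyProduction, sq]
    exact le_add_of_nonneg_right (mul_self_nonneg _)
  have hmul := mul_le_mul_of_nonneg_left hsq (mul_nonneg hν (cK_nonneg K hs))
  linarith

lemma nonneg_of_hasDerivAt_of_forall_nonneg {f : ℝ → ℝ} {f' : ℝ} (hf : HasDerivAt f f' 0)
    (h0 : f 0 = 0) (hnonneg : ∀ s, 0 ≤ s → 0 ≤ f s) : 0 ≤ f' := by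
  have h := hf.hasDerivWithinAt (s := Set.Ioi 0)
  rw [hasDerivWithinAt_iff_tendsto_slope' (by simp)] at h
  refine ge_of_tendsto h ?_
  filter_upwards [self_mem_nhdsWithin] with s hs
  rw [slope_def_field, h0, sub_zero, sub_zero]
  exact div_nonneg (hnonneg s (le_of_lt hs)) (le_of_lt hs)

lemma deriv_entropyProduction_le (hsymm : TraciallySymm Q) {d : ℕ} {v : Fin d → Mat ι}
    (hL : LindbladForm Q.gen v) {K ν : ℝ} (hν : 0 ≤ ν) (hGE : GElog Q.P Q.gen v K ν)
    {ρ : Mat ι} (hρ : ρ.PosDef) (hρ1 : trn ρ = 1) {t : ℝ} (ht : 0 ≤ t) :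
    deriv (entropyProduction Q ρ) t ≤
      -(2 * K) * entropyProduction Q ρ t - 2 * ν * entropyProduction Q ρ t ^ 2 := by
  have hψ := (differentiableAt_entropyProduction (eventually_posDef_P (Q := Q) hρ ht)).hasDerivAt
  set ψ := entropyProduction Q ρ with hψdef
  have hshift : HasDerivAt (fun s => ψ (t + s)) (deriv ψ t) 0 := by
    rw [← add_zero t] at hψ
    simpa using hψ.comp_const_add t 0
  have hexp : HasDerivAt (fun s : ℝ => Real.exp (-(2 * K * s))) (-(2 * K)) 0 := by
    have h : HasDerivAt (fun s : ℝ => -(2 * K * s)) (-(2 * K * 1)) 0 :=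
      ((hasDerivAt_id (0 : ℝ)).const_mul (2 * K)).neg
    simpa using h.exp
  have hd := (((hexp.fun_mul hshift).fun_sub
    (((hasDerivAt_cK K).const_mul ν).fun_mul (hshift.fun_pow 2))).fun_sub
      (hshift.const_mul 2)).add_const (ψ t)
  have h := nonneg_of_hasDerivAt_of_forall_nonneg hd ?_ ?_
  · simp only [mul_zero, neg_zero, Real.exp_zero, add_zero, cK_zero, one_mul, zero_mul] at h
    linarith
  · simp [cK_zero]
    ring
  · intro s hs
    have := entropyProduction_le hsymm hL hν hGE hρ hρ1 hs ht
    linarith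

end Semigroup

end CD

namespace CD

/-- If a tracially symmetric quantum Markov semigroup with Lindblad
form satisfies `GE(K,N)` for the logarithmic mean (`K ∈ ℝ`, `N ∈ (0,∞)`), then for
every invertible density matrix `ρ`, `φ(t) := −Ent(P_tρ)` is twice differentiable on
`[0,∞)` with `φ'(t) = τ((L P_tρ) log(P_tρ)) ≥ 0` and
`φ''(t) ≤ −2K·φ'(t) − (2/N)·φ'(t)²`. -/
theorem entropy_derivatives {n d : ℕ} (Q : QMS (Fin n)) (hsymm : TraciallySymm Q)
    (v : Fin d → Mat (Fin n)) (hLind : LindbladForm Q.gen v)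
    (K N : ℝ) (hN : 0 < N) (hGE : GElog Q.P Q.gen v K N⁻¹)
    (ρ : Mat (Fin n)) (hρ : ρ.PosDef) (hρ1 : trn ρ = 1)
    (φ : ℝ → ℝ) (hφ : φ = fun t => -Ent (Q.P t ρ)) :
    ∀ t : ℝ, 0 ≤ t →
      DifferentiableAt ℝ φ t ∧ DifferentiableAt ℝ (deriv φ) t ∧
      deriv φ t = (trn (Q.gen (Q.P t ρ) * mlog (Q.P t ρ))).re ∧
      0 ≤ deriv φ t ∧
      deriv (deriv φ) t ≤ -(2 * K) * deriv φ t - (2 / N) * (deriv φ t) ^ 2 := by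
  intro t ht
  have hder : ∀ s, (∀ᶠ r in nhds s, (Q.P r ρ).PosDef) →
      HasDerivAt φ (entropyProduction Q ρ s) s := by
    intro s hs
    rw [hφ]
    exact hasDerivAt_neg_Ent_P hsymm hs
  have hev := eventually_posDef_P (Q := Q) hρ ht
  have hderiv : deriv φ =ᶠ[nhds t] entropyProduction Q ρ := by
    filter_upwards [hev.eventually_nhds] with s hs
    exact (hder s hs).deriv
  have hφt : deriv φ t = entropyProduction Q ρ t := hderiv.self_of_nhds
  refine ⟨(hder t hev).differentiableAt,
    (differentiableAt_entropyProduction hev).congr_of_eventuallyEq hderiv, hφt, ?_, ?_⟩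
  · rw [hφt]
    exact entropyProduction_nonneg hLind hev.self_of_nhds
  · rw [hderiv.deriv_eq, hφt, div_eq_mul_inv]
    exact deriv_entropyProduction_le hsymm hLind (inv_nonneg.2 hN.le) hGE hρ hρ1 ht

end CD
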